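/- Let D ≥ 1, let λ ∈ (0,1], let μ ∈ ℝ^D with μ ≠ 0, and let (a_i)_{i=1}^D and (s_i)_{i=1}^D be real numbers with a_i ≥ 0 and s_i > 0 for every i. Then (1−λ)²‖μ‖² + Σ_{i=1}^D ( √(a_i² + s_i²) − √(a_i² + λ² s_i²) )² < ‖μ‖² + Σ_{i=1}^D ( √(a_i² + s_i²) − a_i )². -/

import Mathlib

open Real Finset

/-- Partially inflating the standard deviation `a` by independent noise moves it closer to
the fully inflated standard deviation. -/
theorem sq_sqrt_sub_sqrt_le_sq_sqrt_sub {a s lam : ℝ} (hlam0 : 0 ≤ lam) (hlam1 : lam ≤ 1) :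
    (√(a ^ 2 + s ^ 2) - √(a ^ 2 + lam ^ 2 * s ^ 2)) ^ 2 ≤ (√(a ^ 2 + s ^ 2) - a) ^ 2 := by
  have hlam : lam ^ 2 * s ^ 2 ≤ s ^ 2 :=
    mul_le_of_le_one_left (sq_nonneg s) (pow_le_one₀ hlam0 hlam1)
  have hlower : a ≤ √(a ^ 2 + lam ^ 2 * s ^ 2) :=
    Real.le_sqrt_of_sq_le (le_add_of_nonneg_right (by positivity))
  have hupper : √(a ^ 2 + lam ^ 2 * s ^ 2) ≤ √(a ^ 2 + s ^ 2) :=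
    Real.sqrt_le_sqrt (by gcongr)
  exact pow_le_pow_left₀ (sub_nonneg.mpr hupper) (sub_le_sub_left hlower _) 2

/-- **Noise-Augmented Embeddings Improve Distributional Fidelity** (Theorem 1).
With `μ` the mean quantization residual, `a i` the eigen-standard-deviations of the
quantized-embedding covariance and `s i` those of the residual covariance, the
2-Wasserstein distance of the noise-augmented distribution to the true distribution,
`(1-λ)²‖μ‖² + Σ (√(aᵢ²+sᵢ²) − √(aᵢ²+λ²sᵢ²))²`, is strictly smaller than that of the
raw quantized distribution, `‖μ‖² + Σ (√(aᵢ²+sᵢ²) − aᵢ)²`. -/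
theorem noise_augmented_improves_fidelity
    (D : ℕ) (hD : 1 ≤ D) (lam : ℝ) (hlam0 : 0 < lam) (hlam1 : lam ≤ 1)
    (μ : EuclideanSpace ℝ (Fin D)) (hμ : μ ≠ 0)
    (a s : Fin D → ℝ) (ha : ∀ i, 0 ≤ a i) (hs : ∀ i, 0 < s i) :
    (1 - lam) ^ 2 * ‖μ‖ ^ 2 +
        ∑ i, (Real.sqrt ((a i) ^ 2 + (s i) ^ 2)
                - Real.sqrt ((a i) ^ 2 + lam ^ 2 * (s i) ^ 2)) ^ 2
      < ‖μ‖ ^ 2 + ∑ i, (Real.sqrt ((a i) ^ 2 + (s i) ^ 2) - a i) ^ 2 := by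
  have hμ_pos : 0 < ‖μ‖ ^ 2 := pow_pos (norm_pos_iff.mpr hμ) 2
  have hmean : (1 - lam) ^ 2 < 1 :=
    pow_lt_one₀ (sub_nonneg.mpr hlam1) (sub_lt_self 1 hlam0) two_ne_zero
  exact add_lt_add_of_lt_of_le (mul_lt_of_lt_one_left hμ_pos hmean)
    (Finset.sum_le_sum fun i _ => sq_sqrt_sub_sqrt_le_sq_sqrt_sub hlam0.le hlam1)
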